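/- For i = 1, 2 let 1 ≤ n_i < k_i and let π_i : ℝ^{k_i} → ℝ^{n_i} be linear maps, each injective on ℤ^{k_i} and with π_i(ℤ^{k_i}) dense in ℝ^{n_i}; set δ_i = (k_i − n_i)/n_i. Let π = π₁ × π₂ : ℝ^{k₁+k₂} → ℝ^{n₁+n₂} be the product map π(v₁, v₂) = (π₁(v₁), π₂(v₂)), and let δ = (k₁+k₂−n₁−n₂)/(n₁+n₂). Then: (i) if δ₁ ≠ δ₂, the projected lattice π(ℤ^{k₁+k₂}) is not Diophantine (with exponent δ); (ii) if δ₁ = δ₂, then π(ℤ^{k₁+k₂}) is Diophantine (with exponent δ) if and only if both π₁(ℤ^{k₁}) and π₂(ℤ^{k₂}) are Diophantine (with exponents δ₁, δ₂ respectively). -/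

import Mathlib

/-- The projected lattice `π(ℤ^k)` is Diophantine with exponent `δ`. -/
def IsDioph {k n : ℕ} (π : (Fin k → ℝ) →ₗ[ℝ] (Fin n → ℝ)) (δ : ℝ) : Prop :=
  ∃ c > 0, ∀ v : Fin k → ℤ, v ≠ 0 →
    c * ‖(fun i => (v i : ℝ) : Fin k → ℝ)‖ ^ (-δ) ≤ ‖π fun i => (v i : ℝ)‖

/-- The product projected lattice `(π₁ × π₂)(ℤ^{k₁+k₂})` is Diophantine with exponent `δ`. -/
def IsDiophProd {k₁ k₂ n₁ n₂ : ℕ}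
    (π₁ : (Fin k₁ → ℝ) →ₗ[ℝ] (Fin n₁ → ℝ)) (π₂ : (Fin k₂ → ℝ) →ₗ[ℝ] (Fin n₂ → ℝ))
    (δ : ℝ) : Prop :=
  ∃ c > 0, ∀ v : (Fin k₁ → ℤ) × (Fin k₂ → ℤ), v ≠ 0 →
    c * ‖(((fun i => (v.1 i : ℝ)), (fun i => (v.2 i : ℝ))) :
          (Fin k₁ → ℝ) × (Fin k₂ → ℝ))‖ ^ (-δ)
      ≤ ‖((π₁ fun i => (v.1 i : ℝ)), (π₂ fun i => (v.2 i : ℝ)))‖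

/-- Dirichlet's theorem for a linear map: the box `[-3mⁿ, 3mⁿ]^k` contains a nonzero integer vector
whose image has norm at most `L * (3 * mⁿ) / m ^ k`. -/
theorem exists_int_vector_norm_map_le {k n : ℕ} (hnk : n < k)
    (π : (Fin k → ℝ) →ₗ[ℝ] (Fin n → ℝ)) {L : ℝ} (hL : 0 < L) (hπ : ∀ x, ‖π x‖ ≤ L * ‖x‖)
    {m : ℕ} (hm : 1 ≤ m) :
    ∃ v : Fin k → ℤ, v ≠ 0 ∧ ‖(fun i => (v i : ℝ) : Fin k → ℝ)‖ ≤ 3 * (m : ℝ) ^ n ∧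
      ‖π fun i => (v i : ℝ)‖ ≤ L * (3 * (m : ℝ) ^ n) / (m : ℝ) ^ k := by
  have hm' : (0 : ℝ) < m := by exact_mod_cast hm
  set ε : ℝ := L * (3 * (m : ℝ) ^ n) / (m : ℝ) ^ k with hε
  have hεpos : 0 < ε := by positivity
  let S : Finset (Fin k → ℤ) := Fintype.piFinset fun _ => Finset.Icc 0 (3 * (m : ℤ) ^ n)
  let T : Finset (Fin n → ℤ) :=
    Fintype.piFinset fun _ => Finset.Icc (-(m : ℤ) ^ k) ((m : ℤ) ^ k)
  let f : (Fin k → ℤ) → Fin n → ℤ := fun v j => ⌊π (fun i => (v i : ℝ)) j / ε⌋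
  have hS : S.card = (3 * m ^ n + 1) ^ k := by
    simp only [S, Fintype.card_piFinset, Int.card_Icc, Finset.prod_const, Finset.card_univ,
      Fintype.card_fin]
    congr 1
  have hT : T.card = (2 * m ^ k + 1) ^ n := by
    simp only [T, Fintype.card_piFinset, Int.card_Icc, Finset.prod_const, Finset.card_univ,
      Fintype.card_fin]
    congr 1
    have h : (0 : ℤ) ≤ (m : ℤ) ^ k := by positivity
    zify
    rw [Int.toNat_of_nonneg (by linarith)]
    ring
  have hcard : T.card < S.card := by
    rw [hS, hT]
    calc (2 * m ^ k + 1) ^ n ≤ (3 * m ^ k) ^ n := by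
          have : 1 ≤ m ^ k := Nat.one_le_pow _ _ hm
          exact Nat.pow_le_pow_left (by omega) n
      _ = 3 ^ n * (m ^ n) ^ k := by rw [mul_pow, ← pow_mul, ← pow_mul, mul_comm k n]
      _ ≤ 3 ^ k * (m ^ n) ^ k :=
          Nat.mul_le_mul_right _ (Nat.pow_le_pow_right (by norm_num) hnk.le)
      _ = (3 * m ^ n) ^ k := (mul_pow _ _ _).symm
      _ < (3 * m ^ n + 1) ^ k := Nat.pow_lt_pow_left (Nat.lt_succ_self _) (by omega)
  have hmaps : ∀ v ∈ S, f v ∈ T := by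
    intro v hv
    simp only [S, Fintype.mem_piFinset, Finset.mem_Icc] at hv
    have hnorm : ‖(fun i => (v i : ℝ) : Fin k → ℝ)‖ ≤ 3 * (m : ℝ) ^ n := by
      refine (pi_norm_le_iff_of_nonneg (by positivity)).2 fun i => ?_
      have h0 : (0 : ℝ) ≤ v i := by exact_mod_cast (hv i).1
      rw [Real.norm_of_nonneg h0]
      exact_mod_cast (hv i).2
    simp only [T, Fintype.mem_piFinset, Finset.mem_Icc]
    intro j
    have hj : |π (fun i => (v i : ℝ)) j| ≤ (m : ℝ) ^ k * ε := by
      calc |π (fun i => (v i : ℝ)) j| ≤ ‖π fun i => (v i : ℝ)‖ := norm_le_pi_norm (π fun i => (v i : ℝ)) j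
        _ ≤ L * ‖(fun i => (v i : ℝ) : Fin k → ℝ)‖ := hπ _
        _ ≤ L * (3 * (m : ℝ) ^ n) := by gcongr
        _ = (m : ℝ) ^ k * ε := by rw [hε]; field_simp
    obtain ⟨h1, h2⟩ := abs_le.1 hj
    constructor
    · rw [Int.le_floor, le_div_iff₀ hεpos]
      push_cast
      linarith
    · have : (⌊π (fun i => (v i : ℝ)) j / ε⌋ : ℝ) ≤ (m : ℝ) ^ k :=
        (Int.floor_le _).trans ((div_le_iff₀ hεpos).2 h2)
      exact_mod_cast this
  obtain ⟨v, hv, w, hw, hvw, hf⟩ := Finset.exists_ne_map_eq_of_card_lt_of_maps_to hcard hmaps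
  simp only [S, Fintype.mem_piFinset, Finset.mem_Icc] at hv hw
  refine ⟨v - w, sub_ne_zero.2 hvw, ?_, ?_⟩
  · refine (pi_norm_le_iff_of_nonneg (by positivity)).2 fun i => ?_
    have h : |(v - w) i| ≤ 3 * (m : ℤ) ^ n := by
      obtain ⟨h1, h2⟩ := hv i
      obtain ⟨h3, h4⟩ := hw i
      rw [Pi.sub_apply, abs_le]
      constructor <;> linarith
    rw [Real.norm_eq_abs]
    exact_mod_cast h
  · have hsub : (fun i => (((v - w) i : ℤ) : ℝ)) =
        (fun i => (v i : ℝ)) - fun i => (w i : ℝ) := by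
      ext i
      simp
    rw [hsub, map_sub]
    refine (pi_norm_le_iff_of_nonneg hεpos.le).2 fun j => ?_
    have h := (Int.abs_sub_lt_one_of_floor_eq_floor (congrFun hf j)).le
    rwa [← sub_div, abs_div, abs_of_pos hεpos, div_le_one hεpos] at h

/-- A projected lattice is not Diophantine with any exponent below the Dirichlet exponent. -/
theorem not_isDioph_of_lt {k n : ℕ} (hn : 1 ≤ n) (hnk : n < k)
    (π : (Fin k → ℝ) →ₗ[ℝ] (Fin n → ℝ)) {δ : ℝ} (hδ : 0 ≤ δ)
    (hlt : δ < ((k : ℝ) - n) / n) : ¬ IsDioph π δ := by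
  rintro ⟨c, hc, h⟩
  have hn' : (0 : ℝ) < n := by exact_mod_cast hn
  set L : ℝ := ‖LinearMap.toContinuousLinearMap π‖ + 1 with hLdef
  have hL : 0 < L := by positivity
  have hπ : ∀ x, ‖π x‖ ≤ L * ‖x‖ := fun x =>
    ((LinearMap.toContinuousLinearMap π).le_opNorm x).trans
      (by rw [hLdef]; gcongr; linarith)
  set s : ℝ := (k : ℝ) - n - n * δ with hs
  have hspos : 0 < s := by
    have := (lt_div_iff₀ hn').1 hlt
    rw [hs]
    linarith
  have hbound : ∀ m : ℕ, 1 ≤ m → c * 3 ^ (-δ) * (m : ℝ) ^ s ≤ 3 * L := by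
    intro m hm
    have hm' : (0 : ℝ) < m := by exact_mod_cast hm
    obtain ⟨v, hv0, hv, hπv⟩ := exists_int_vector_norm_map_le hnk π hL hπ hm
    have hvpos : 0 < ‖(fun i => (v i : ℝ) : Fin k → ℝ)‖ := by
      refine norm_pos_iff.2 fun h0 => hv0 ?_
      ext i
      simpa using congrFun h0 i
    have h1 : c * (3 * (m : ℝ) ^ n) ^ (-δ) ≤ L * (3 * (m : ℝ) ^ n) / (m : ℝ) ^ k :=
      calc c * (3 * (m : ℝ) ^ n) ^ (-δ)
          ≤ c * ‖(fun i => (v i : ℝ) : Fin k → ℝ)‖ ^ (-δ) :=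
            mul_le_mul_of_nonneg_left
              (Real.rpow_le_rpow_of_nonpos hvpos hv (neg_nonpos.2 hδ)) hc.le
        _ ≤ _ := (h v hv0).trans hπv
    have h2 : (3 * (m : ℝ) ^ n) ^ (-δ) = 3 ^ (-δ) * (m : ℝ) ^ (-(n * δ)) := by
      rw [Real.mul_rpow (by norm_num) (by positivity), ← Real.rpow_natCast_mul hm'.le, mul_neg]
    have h3 : (m : ℝ) ^ s = (m : ℝ) ^ (-(n * δ)) * ((m : ℝ) ^ k / (m : ℝ) ^ n) := by
      rw [← Real.rpow_natCast, ← Real.rpow_natCast, ← Real.rpow_sub hm', ← Real.rpow_add hm', hs]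
      ring_nf
    rw [h2, le_div_iff₀ (by positivity)] at h1
    rw [h3, ← mul_div_assoc, ← mul_div_assoc, div_le_iff₀ (by positivity)]
    linarith
  have htend : Filter.Tendsto (fun m : ℕ => c * 3 ^ (-δ) * (m : ℝ) ^ s)
      Filter.atTop Filter.atTop :=
    ((tendsto_rpow_atTop hspos).comp tendsto_natCast_atTop_atTop).const_mul_atTop
      (by positivity)
  obtain ⟨m, hm, hm1⟩ :=
    ((htend.eventually_gt_atTop (3 * L)).and (Filter.eventually_ge_atTop 1)).exists
  exact absurd (hbound m hm1) (not_le.2 hm)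

section Product

variable {k₁ k₂ n₁ n₂ : ℕ} {π₁ : (Fin k₁ → ℝ) →ₗ[ℝ] (Fin n₁ → ℝ)}
  {π₂ : (Fin k₂ → ℝ) →ₗ[ℝ] (Fin n₂ → ℝ)} {δ : ℝ}

theorem IsDiophProd.fst (h : IsDiophProd π₁ π₂ δ) : IsDioph π₁ δ := by
  obtain ⟨c, hc, h⟩ := h
  refine ⟨c, hc, fun v hv => ?_⟩
  have hz : (fun _ : Fin k₂ => (0 : ℝ)) = 0 := rfl
  simpa [Prod.norm_mk, hz] using h (v, 0) (by simpa using hv)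

theorem IsDiophProd.snd (h : IsDiophProd π₁ π₂ δ) : IsDioph π₂ δ := by
  obtain ⟨c, hc, h⟩ := h
  refine ⟨c, hc, fun v hv => ?_⟩
  have hz : (fun _ : Fin k₁ => (0 : ℝ)) = 0 := rfl
  simpa [Prod.norm_mk, hz] using h (0, v) (by simpa using hv)

theorem IsDioph.prod (h₁ : IsDioph π₁ δ) (h₂ : IsDioph π₂ δ) : IsDiophProd π₁ π₂ δ := by
  obtain ⟨c₁, hc₁, h₁⟩ := h₁
  obtain ⟨c₂, hc₂, h₂⟩ := h₂
  refine ⟨min c₁ c₂, lt_min hc₁ hc₂, fun ⟨v, w⟩ hvw => ?_⟩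
  simp only [Prod.norm_mk]
  rcases le_total ‖(fun i => (w i : ℝ) : Fin k₂ → ℝ)‖ ‖(fun i => (v i : ℝ) : Fin k₁ → ℝ)‖
    with hle | hle
  · have hv : v ≠ 0 := by
      rintro rfl
      refine hvw (Prod.ext rfl ?_)
      ext i
      have h0 := (norm_le_pi_norm (fun i => (w i : ℝ)) i).trans hle
      have hz : (fun _ : Fin k₁ => (0 : ℝ)) = 0 := rfl
      simpa [hz] using h0
    rw [max_eq_left hle]
    exact (mul_le_mul_of_nonneg_right (min_le_left _ _) (by positivity)).trans
      ((h₁ v hv).trans (le_max_left _ _))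
  · have hw : w ≠ 0 := by
      rintro rfl
      refine hvw (Prod.ext ?_ rfl)
      ext i
      have h0 := (norm_le_pi_norm (fun i => (v i : ℝ)) i).trans hle
      have hz : (fun _ : Fin k₂ => (0 : ℝ)) = 0 := rfl
      simpa [hz] using h0
    rw [max_eq_right hle]
    exact (mul_le_mul_of_nonneg_right (min_le_right _ _) (by positivity)).trans
      ((h₂ w hw).trans (le_max_right _ _))

end Product

/-- For two cut and project projections with exponents `δᵢ = (kᵢ−nᵢ)/nᵢ`
and the product map with exponent `δ = (k₁+k₂−n₁−n₂)/(n₁+n₂)`: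
(i) if `δ₁ ≠ δ₂` the product lattice is not Diophantine;
(ii) if `δ₁ = δ₂` the product lattice is Diophantine iff both factors are. -/
theorem stmt_12 (k₁ k₂ n₁ n₂ : ℕ)
    (hn₁ : 1 ≤ n₁) (hk₁ : n₁ < k₁) (hn₂ : 1 ≤ n₂) (hk₂ : n₂ < k₂)
    (π₁ : (Fin k₁ → ℝ) →ₗ[ℝ] (Fin n₁ → ℝ)) (π₂ : (Fin k₂ → ℝ) →ₗ[ℝ] (Fin n₂ → ℝ))
    (hinj₁ : ∀ v w : Fin k₁ → ℤ,
      π₁ (fun i => (v i : ℝ)) = π₁ (fun i => (w i : ℝ)) → v = w)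
    (hdense₁ : Dense (Set.range fun v : Fin k₁ → ℤ => π₁ fun i => (v i : ℝ)))
    (hinj₂ : ∀ v w : Fin k₂ → ℤ,
      π₂ (fun i => (v i : ℝ)) = π₂ (fun i => (w i : ℝ)) → v = w)
    (hdense₂ : Dense (Set.range fun v : Fin k₂ → ℤ => π₂ fun i => (v i : ℝ))) :
    ((((k₁ : ℝ) - n₁) / n₁ ≠ ((k₂ : ℝ) - n₂) / n₂) →
      ¬ IsDiophProd π₁ π₂ (((k₁ : ℝ) + k₂ - n₁ - n₂) / ((n₁ : ℝ) + n₂))) ∧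
    ((((k₁ : ℝ) - n₁) / n₁ = ((k₂ : ℝ) - n₂) / n₂) →
      (IsDiophProd π₁ π₂ (((k₁ : ℝ) + k₂ - n₁ - n₂) / ((n₁ : ℝ) + n₂)) ↔
        IsDioph π₁ (((k₁ : ℝ) - n₁) / n₁) ∧ IsDioph π₂ (((k₂ : ℝ) - n₂) / n₂))) := by
  have hn₁' : (0 : ℝ) < n₁ := by exact_mod_cast hn₁
  have hn₂' : (0 : ℝ) < n₂ := by exact_mod_cast hn₂
  have hk₁' : (n₁ : ℝ) < k₁ := by exact_mod_cast hk₁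
  have hk₂' : (n₂ : ℝ) < k₂ := by exact_mod_cast hk₂
  constructor
  · intro hne h
    have hδ : 0 ≤ ((k₁ : ℝ) + k₂ - n₁ - n₂) / ((n₁ : ℝ) + n₂) :=
      div_nonneg (by linarith) (by linarith)
    rcases lt_or_gt_of_ne hne with hlt | hlt
    · refine not_isDioph_of_lt hn₂ hk₂ π₂ hδ ?_ h.snd
      rw [div_lt_div_iff₀ (by positivity) (by positivity)] at hlt ⊢
      linarith
    · refine not_isDioph_of_lt hn₁ hk₁ π₁ hδ ?_ h.fst
      rw [div_lt_div_iff₀ (by positivity) (by positivity)] at hlt ⊢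
      linarith
  · intro heq
    have hδ : ((k₁ : ℝ) + k₂ - n₁ - n₂) / ((n₁ : ℝ) + n₂) = ((k₁ : ℝ) - n₁) / n₁ := by
      rw [div_eq_div_iff (by positivity) (by positivity)] at heq ⊢
      linarith
    rw [← heq, hδ]
    exact ⟨fun h => ⟨h.fst, h.snd⟩, fun h => h.1.prod h.2⟩
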